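/- (Global linear convergence of the Gauss-Newton method.) Let K⁰ ∈ 𝕂. For any step size 0 < η ≤ 1/2, the iterates defined by K^{n+1}_i = K^n_i − 2η(R_i + B_iᵀ E_i(P^{K^n}) B_i)^{−1} L^{K^n}_i satisfy K^n ∈ 𝕂 for every n ≥ 0 and C(K^n) − C(K*) ≤ (1 − 2μη/‖𝐗^{K*}‖_max)^n · (C(K⁰) − C(K*)). -/

import Mathlib

open Matrix Filter
open scoped Kronecker Topology

namespace MJLS

noncomputable section

attribute [local instance] Classical.propDecidable

/-- Closed-loop matrices `Γ i = A i - B i * K i`. -/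
def Gam {d k N : ℕ} (A : Fin N → Matrix (Fin d) (Fin d) ℝ)
    (B : Fin N → Matrix (Fin d) (Fin k) ℝ)
    (K : Fin N → Matrix (Fin k) (Fin d) ℝ) : Fin N → Matrix (Fin d) (Fin d) ℝ :=
  fun i => A i - B i * K i

/-- The operator `E_i(V) = ∑ j, p i j • V j`. -/
def opE {d N : ℕ} (Pr : Matrix (Fin N) (Fin N) ℝ)
    (V : Fin N → Matrix (Fin d) (Fin d) ℝ) : Fin N → Matrix (Fin d) (Fin d) ℝ :=
  fun i => ∑ j, Pr i j • V j

/-- The matrix `𝒜 = diag(Γᵀ ⊗ Γᵀ) (P ⊗ I)`. -/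
def calA {d N : ℕ} (Pr : Matrix (Fin N) (Fin N) ℝ)
    (Γ : Fin N → Matrix (Fin d) (Fin d) ℝ) :
    Matrix (Fin N × Fin d × Fin d) (Fin N × Fin d × Fin d) ℝ :=
  (Matrix.reindex (Equiv.prodComm (Fin d × Fin d) (Fin N))
      (Equiv.prodComm (Fin d × Fin d) (Fin N))
      (Matrix.blockDiagonal fun i => (Γ i)ᵀ ⊗ₖ (Γ i)ᵀ)) *
    (Pr ⊗ₖ (1 : Matrix (Fin d × Fin d) (Fin d × Fin d) ℝ))

/-- `K` is mean-square stabilizing: the spectral radius of `𝒜` is less than `1`. -/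
def MSS {d k N : ℕ} (Pr : Matrix (Fin N) (Fin N) ℝ)
    (A : Fin N → Matrix (Fin d) (Fin d) ℝ) (B : Fin N → Matrix (Fin d) (Fin k) ℝ)
    (K : Fin N → Matrix (Fin k) (Fin d) ℝ) : Prop :=
  spectralRadius ℂ ((calA Pr (Gam A B K)).map (algebraMap ℝ ℂ)) < 1

/-- `P` solves the coupled Lyapunov equations for the policy `K`. -/
def IsLyap {d k N : ℕ} (Pr : Matrix (Fin N) (Fin N) ℝ)
    (A : Fin N → Matrix (Fin d) (Fin d) ℝ) (B : Fin N → Matrix (Fin d) (Fin k) ℝ)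
    (Q : Fin N → Matrix (Fin d) (Fin d) ℝ) (R : Fin N → Matrix (Fin k) (Fin k) ℝ)
    (K : Fin N → Matrix (Fin k) (Fin d) ℝ)
    (P : Fin N → Matrix (Fin d) (Fin d) ℝ) : Prop :=
  ∀ i, P i = Q i + (K i)ᵀ * R i * K i + (Gam A B K i)ᵀ * opE Pr P i * Gam A B K i

/-- `P^K`, the (for mean-square stabilizing `K`, unique) solution of the coupled
Lyapunov equations. -/
def PK {d k N : ℕ} (Pr : Matrix (Fin N) (Fin N) ℝ)
    (A : Fin N → Matrix (Fin d) (Fin d) ℝ) (B : Fin N → Matrix (Fin d) (Fin k) ℝ)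
    (Q : Fin N → Matrix (Fin d) (Fin d) ℝ) (R : Fin N → Matrix (Fin k) (Fin k) ℝ)
    (K : Fin N → Matrix (Fin k) (Fin d) ℝ) : Fin N → Matrix (Fin d) (Fin d) ℝ :=
  if h : ∃ P, IsLyap Pr A B Q R K P then h.choose else 0

/-- The LQR cost `C(K) = ∑ i, π i * tr(P^K_i Sg)`. -/
def cost {d k N : ℕ} (Pr : Matrix (Fin N) (Fin N) ℝ)
    (A : Fin N → Matrix (Fin d) (Fin d) ℝ) (B : Fin N → Matrix (Fin d) (Fin k) ℝ)
    (Q : Fin N → Matrix (Fin d) (Fin d) ℝ) (R : Fin N → Matrix (Fin k) (Fin k) ℝ)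
    (piv : Fin N → ℝ) (Sg : Matrix (Fin d) (Fin d) ℝ)
    (K : Fin N → Matrix (Fin k) (Fin d) ℝ) : ℝ :=
  ∑ i, piv i * (PK Pr A B Q R K i * Sg).trace

/-- The operator `T_j(V) = ∑ i, p i j • (Γ i * V i * Γ iᵀ)`. -/
def opT {d N : ℕ} (Pr : Matrix (Fin N) (Fin N) ℝ)
    (Γ : Fin N → Matrix (Fin d) (Fin d) ℝ)
    (V : Fin N → Matrix (Fin d) (Fin d) ℝ) : Fin N → Matrix (Fin d) (Fin d) ℝ :=
  fun j => ∑ i, Pr i j • (Γ i * V i * (Γ i)ᵀ)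

/-- `𝐗^K = ∑_{t=0}^∞ T^t(X(0))` with `X_i(0) = π i • Sg`. -/
def XK {d N : ℕ} (Pr : Matrix (Fin N) (Fin N) ℝ) (piv : Fin N → ℝ)
    (Sg : Matrix (Fin d) (Fin d) ℝ) (Γ : Fin N → Matrix (Fin d) (Fin d) ℝ) :
    Fin N → Matrix (Fin d) (Fin d) ℝ :=
  ∑' t : ℕ, (opT Pr Γ)^[t] (fun i => piv i • Sg)

/-- `L^K_i = (R i + B iᵀ E_i(P^K) B i) K i - B iᵀ E_i(P^K) A i`. -/
def LK {d k N : ℕ} (Pr : Matrix (Fin N) (Fin N) ℝ)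
    (A : Fin N → Matrix (Fin d) (Fin d) ℝ) (B : Fin N → Matrix (Fin d) (Fin k) ℝ)
    (Q : Fin N → Matrix (Fin d) (Fin d) ℝ) (R : Fin N → Matrix (Fin k) (Fin k) ℝ)
    (K : Fin N → Matrix (Fin k) (Fin d) ℝ) : Fin N → Matrix (Fin k) (Fin d) ℝ :=
  fun i => (R i + (B i)ᵀ * opE Pr (PK Pr A B Q R K) i * B i) * K i
    - (B i)ᵀ * opE Pr (PK Pr A B Q R K) i * A i

/-- The operator `L_i(V) = Γ iᵀ E_i(V) Γ i`. -/
def opL {d N : ℕ} (Pr : Matrix (Fin N) (Fin N) ℝ)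
    (Γ : Fin N → Matrix (Fin d) (Fin d) ℝ)
    (V : Fin N → Matrix (Fin d) (Fin d) ℝ) : Fin N → Matrix (Fin d) (Fin d) ℝ :=
  fun i => (Γ i)ᵀ * opE Pr V i * Γ i

/-- `(P^K)'[E] = ∑_{t=0}^∞ L^t(Eᵀ L^K + (L^K)ᵀ E)`. -/
def PKd {d k N : ℕ} (Pr : Matrix (Fin N) (Fin N) ℝ)
    (Γ : Fin N → Matrix (Fin d) (Fin d) ℝ)
    (Lk E : Fin N → Matrix (Fin k) (Fin d) ℝ) : Fin N → Matrix (Fin d) (Fin d) ℝ :=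
  ∑' t : ℕ, (opL Pr Γ)^[t] (fun i => (E i)ᵀ * Lk i + (Lk i)ᵀ * E i)

/-- `‖V‖₂² = ∑ i, tr(V iᵀ V i)`. -/
def norm2sq {a b N : ℕ} (V : Fin N → Matrix (Fin a) (Fin b) ℝ) : ℝ :=
  ∑ i, ((V i)ᵀ * V i).trace

/-- The inner product `⟨V, S⟩ = ∑ i, tr(V iᵀ S i)`. -/
def ip {a b N : ℕ} (V S : Fin N → Matrix (Fin a) (Fin b) ℝ) : ℝ :=
  ∑ i, ((V i)ᵀ * S i).trace

/-- The spectral norm (maximal singular value) of a matrix. -/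
def specNorm {a b : ℕ} (M : Matrix (Fin a) (Fin b) ℝ) : ℝ :=
  ⨆ x : {x : EuclideanSpace ℝ (Fin b) // ‖x‖ ≤ 1}, ‖Matrix.toEuclideanLin M x.1‖

/-- The minimal singular value of a square matrix. -/
def sigmaMin {a : ℕ} (M : Matrix (Fin a) (Fin a) ℝ) : ℝ :=
  ⨅ x : {x : EuclideanSpace ℝ (Fin a) // ‖x‖ = 1}, ‖Matrix.toEuclideanLin M x.1‖

/-- `‖V‖_max = max_i ‖V i‖` (spectral norms). -/
def maxNorm {a b N : ℕ} (V : Fin N → Matrix (Fin a) (Fin b) ℝ) : ℝ :=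
  ⨆ i, specNorm (V i)

/-- `Λ_min(V) = min_i σ_min(V i)`. -/
def lamMin {a N : ℕ} (V : Fin N → Matrix (Fin a) (Fin a) ℝ) : ℝ :=
  ⨅ i, sigmaMin (V i)

/-- `μ = (min_i π i) · σ_min(Sg)`. -/
def mu {d N : ℕ} (piv : Fin N → ℝ) (Sg : Matrix (Fin d) (Fin d) ℝ) : ℝ :=
  (⨅ i, piv i) * sigmaMin Sg

/-- `ξ(α) = (1/Λ_min(Q))·((1 + ‖B‖²_max)·α/μ + ‖R‖_max) − 1`. -/
def xi {d k N : ℕ} (B : Fin N → Matrix (Fin d) (Fin k) ℝ)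
    (R : Fin N → Matrix (Fin k) (Fin k) ℝ) (Q : Fin N → Matrix (Fin d) (Fin d) ℝ)
    (piv : Fin N → ℝ) (Sg : Matrix (Fin d) (Fin d) ℝ) (α : ℝ) : ℝ :=
  (1 / lamMin Q) * ((1 + maxNorm B ^ 2) * α / mu piv Sg + maxNorm R) - 1

/-- The smoothness constant
`L(α) = 2·(‖R‖_max + ‖B‖²_max·(1 + 2ξ(α)/‖B‖_max)·α/μ)·α/Λ_min(Q)`. -/
def Lsm {d k N : ℕ} (B : Fin N → Matrix (Fin d) (Fin k) ℝ)
    (R : Fin N → Matrix (Fin k) (Fin k) ℝ) (Q : Fin N → Matrix (Fin d) (Fin d) ℝ)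
    (piv : Fin N → ℝ) (Sg : Matrix (Fin d) (Fin d) ℝ) (α : ℝ) : ℝ :=
  2 * (maxNorm R + maxNorm B ^ 2 * (1 + 2 * xi B R Q piv Sg α / maxNorm B)
      * α / mu piv Sg) * α / lamMin Q

end

theorem summable_iter_of_radius {n : Type*} [Fintype n] [DecidableEq n] (M : Matrix n n ℝ)
    (h : spectralRadius ℂ (M.map (algebraMap ℝ ℂ)) < 1) (v : n → ℝ) :
    Summable (fun t : ℕ => (M.mulVec)^[t] v) := by
  let _ : NormedRing (Matrix n n ℂ) := Matrix.linftyOpNormedRing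
  let _ : NormedAlgebra ℂ (Matrix n n ℂ) := Matrix.linftyOpNormedAlgebra
  set a := M.map (algebraMap ℝ ℂ) with ha
  have hg := spectrum.pow_nnnorm_pow_one_div_tendsto_nhds_spectralRadius a
  obtain ⟨r, hr1, hr2⟩ := ENNReal.lt_iff_exists_nnreal_btwn.1 h
  have hev := hg.eventually (gt_mem_nhds hr1)
  have hr1' : r < 1 := by exact_mod_cast hr2
  have hev2 : ∀ᶠ t : ℕ in atTop, ‖a ^ t‖ ≤ (r : ℝ) ^ t := by
    filter_upwards [hev, eventually_gt_atTop 0] with t ht ht0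
    have ht' := ENNReal.rpow_le_rpow ht.le (z := (t : ℝ)) (by positivity)
    rw [← ENNReal.rpow_mul, one_div, inv_mul_cancel₀ (by positivity), ENNReal.rpow_one,
      ENNReal.rpow_natCast] at ht'
    exact_mod_cast ht'
  have hs : Summable (fun t : ℕ => a ^ t) := by
    refine Summable.of_norm_bounded_eventually_nat (g := fun t => (r : ℝ) ^ t) ?_ hev2
    exact summable_geometric_of_lt_one r.2 (by exact_mod_cast hr1')
  have hpow : ∀ t : ℕ, a ^ t = (M ^ t).map (algebraMap ℝ ℂ) := by
    intro t
    rw [ha, ← RingHom.mapMatrix_apply, ← RingHom.mapMatrix_apply, map_pow]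
  have hit : ∀ t : ℕ, (M.mulVec)^[t] v = (M ^ t).mulVec v := by
    intro t
    induction t with
    | zero => simp
    | succ t ih => rw [Function.iterate_succ_apply', ih, pow_succ', Matrix.mulVec_mulVec]
  have hent : ∀ p q, Summable (fun t : ℕ => (M ^ t) p q) := by
    intro p q
    have h1 : Summable (fun t : ℕ => (a ^ t) p q) := by
      have := hs.map (Matrix.entryAddMonoidHom ℂ p q) (by
        exact (continuous_id.matrix_elem p q))
      exact this
    have h2 := Complex.hasSum_re h1.hasSum
    have := h2.summable
    simpa [hpow] using this
  rw [Pi.summable]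
  intro p
  simp only [hit, Matrix.mulVec, dotProduct]
  exact summable_sum (fun q _ => (hent p q).mul_right _)

theorem radius_lt_of_tendsto {n : Type*} [Fintype n] [DecidableEq n] (M : Matrix n n ℝ)
    (h : ∀ v, Tendsto (fun t : ℕ => (M.mulVec)^[t] v) atTop (𝓝 0)) :
    spectralRadius ℂ (M.map (algebraMap ℝ ℂ)) < 1 := by
  rcases isEmpty_or_nonempty n with hn | hn
  · have : Subsingleton (Matrix n n ℂ) := inferInstance
    rw [Subsingleton.elim (M.map (algebraMap ℝ ℂ)) 0]
    simp
  let _ : NormedRing (Matrix n n ℂ) := Matrix.linftyOpNormedRing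
  let _ : NormedAlgebra ℂ (Matrix n n ℂ) := Matrix.linftyOpNormedAlgebra
  have : NormOneClass (Matrix n n ℂ) := Matrix.linfty_opNormOneClass
  set a := M.map (algebraMap ℝ ℂ) with ha
  have hpow : ∀ t : ℕ, a ^ t = (M ^ t).map (algebraMap ℝ ℂ) := by
    intro t
    rw [ha, ← RingHom.mapMatrix_apply, ← RingHom.mapMatrix_apply, map_pow]
  have hit : ∀ v, ∀ t : ℕ, (M.mulVec)^[t] v = (M ^ t).mulVec v := by
    intro v t
    induction t with
    | zero => simp
    | succ t ih => rw [Function.iterate_succ_apply', ih, pow_succ', Matrix.mulVec_mulVec]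
  have hent : ∀ p q, Tendsto (fun t : ℕ => (M ^ t) p q) atTop (𝓝 0) := by
    intro p q
    have := (tendsto_pi_nhds.1 (h (Pi.single q 1))) p
    simpa [hit] using this
  have hT : Tendsto (fun t : ℕ => a ^ t) atTop (𝓝 0) := by
    have : Tendsto (fun t : ℕ => (fun p q => (a ^ t) p q : n → n → ℂ)) atTop (𝓝 0) := by
      rw [tendsto_pi_nhds]; intro p
      rw [tendsto_pi_nhds]; intro q
      have h2 := (Complex.continuous_ofReal.tendsto 0).comp (hent p q)
      simpa [hpow, Function.comp_def] using h2
    exact this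
  have hN : Tendsto (fun t : ℕ => ‖a ^ t‖) atTop (𝓝 0) := by simpa using hT.norm
  obtain ⟨t, ht1, ht0⟩ := ((hN.eventually (gt_mem_nhds one_pos)).and (eventually_gt_atTop 0)).exists
  have h1 : spectralRadius ℂ a ^ t ≤ spectralRadius ℂ (a ^ t) := spectrum.spectralRadius_pow_le a t ht0.ne'
  have h2 : spectralRadius ℂ (a ^ t) ≤ ‖a ^ t‖₊ := spectrum.spectralRadius_le_nnnorm _
  have h3 : spectralRadius ℂ a ^ t < 1 := lt_of_le_of_lt (h1.trans h2) (by exact_mod_cast ht1)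
  by_contra hc
  push Not at hc
  exact absurd (one_le_pow_of_one_le' hc t) (not_le.2 h3)

theorem calA_mulVec {d N : ℕ} (Pr : Matrix (Fin N) (Fin N) ℝ)
    (Γ V : Fin N → Matrix (Fin d) (Fin d) ℝ) :
    (calA Pr Γ).mulVec (fun p => V p.1 p.2.1 p.2.2) =
      fun p => opL Pr Γ V p.1 p.2.1 p.2.2 := by
  have h1 : (Pr ⊗ₖ (1 : Matrix (Fin d × Fin d) (Fin d × Fin d) ℝ)).mulVec
      (fun p => V p.1 p.2.1 p.2.2) = fun p => opE Pr V p.1 p.2.1 p.2.2 := by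
    ext ⟨i, a, b⟩
    simp [Matrix.mulVec, dotProduct, Fintype.sum_prod_type, opE, Matrix.sum_apply,
      Matrix.one_apply]
  have h2 : ∀ W : Fin N → Matrix (Fin d) (Fin d) ℝ, (Matrix.reindex (Equiv.prodComm (Fin d × Fin d) (Fin N))
      (Equiv.prodComm (Fin d × Fin d) (Fin N))
      (Matrix.blockDiagonal fun i => (Γ i)ᵀ ⊗ₖ (Γ i)ᵀ)).mulVec (fun p => W p.1 p.2.1 p.2.2) =
      fun p => ((Γ p.1)ᵀ * W p.1 * Γ p.1) p.2.1 p.2.2 := by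
    intro W
    ext ⟨i, a, b⟩
    simp only [Matrix.mulVec, dotProduct, Fintype.sum_prod_type, Matrix.reindex_apply,
      Matrix.submatrix_apply, Equiv.prodComm_symm, Equiv.prodComm_apply, Prod.swap_prod_mk,
      Matrix.blockDiagonal_apply, Matrix.kroneckerMap_apply, Matrix.transpose_apply, ite_mul, zero_mul,
      Matrix.mul_apply]
    rw [Finset.sum_eq_single i]
    · simp only [if_true, Finset.sum_mul]
      rw [Finset.sum_comm]
      refine Finset.sum_congr rfl fun x _ => Finset.sum_congr rfl fun y _ => ?_
      ring
    · intro j _ hj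
      simp [Ne.symm hj]
    · simp
  have h3 : opL Pr Γ V = fun i => (Γ i)ᵀ * opE Pr V i * Γ i := rfl
  rw [h3, ← h2, ← h1, Matrix.mulVec_mulVec]
  unfold calA
  congr!

theorem calA_iter {d N : ℕ} (Pr : Matrix (Fin N) (Fin N) ℝ)
    (Γ V : Fin N → Matrix (Fin d) (Fin d) ℝ) (t : ℕ) :
    ((calA Pr Γ).mulVec)^[t] (fun p => V p.1 p.2.1 p.2.2) =
      fun p => (opL Pr Γ)^[t] V p.1 p.2.1 p.2.2 := by
  induction t with
  | zero => rfl
  | succ t ih => rw [Function.iterate_succ_apply', ih, calA_mulVec, Function.iterate_succ_apply']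

theorem MSS.summable {d k N : ℕ} {Pr : Matrix (Fin N) (Fin N) ℝ}
    {A : Fin N → Matrix (Fin d) (Fin d) ℝ} {B : Fin N → Matrix (Fin d) (Fin k) ℝ}
    {K : Fin N → Matrix (Fin k) (Fin d) ℝ} (h : MSS Pr A B K)
    (V : Fin N → Matrix (Fin d) (Fin d) ℝ) :
    Summable (fun t : ℕ => (opL Pr (Gam A B K))^[t] V) := by
  have h1 := summable_iter_of_radius _ h (fun p => V p.1 p.2.1 p.2.2)
  simp only [calA_iter] at h1
  rw [Pi.summable] at h1 ⊢
  intro i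
  have : Summable (fun t : ℕ => ((fun a b => (opL Pr (Gam A B K))^[t] V i a b) : Fin d → Fin d → ℝ)) := by
    rw [Pi.summable]; intro a
    rw [Pi.summable]; intro b
    exact h1 (i, a, b)
  exact this

theorem MSS.of_tendsto {d k N : ℕ} {Pr : Matrix (Fin N) (Fin N) ℝ}
    {A : Fin N → Matrix (Fin d) (Fin d) ℝ} {B : Fin N → Matrix (Fin d) (Fin k) ℝ}
    {K : Fin N → Matrix (Fin k) (Fin d) ℝ}
    (h : ∀ V, ∀ i a b, Tendsto (fun t : ℕ => (opL Pr (Gam A B K))^[t] V i a b) atTop (𝓝 0)) :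
    MSS Pr A B K := by
  refine radius_lt_of_tendsto _ fun v => ?_
  let W : Fin N → Matrix (Fin d) (Fin d) ℝ := fun i => Matrix.of fun a b => v (i, a, b)
  rw [tendsto_pi_nhds]
  intro p
  exact (h W p.1 p.2.1 p.2.2).congr fun t => (congrFun (calA_iter Pr (Gam A B K) W t) p).symm

/-- The operator `opL` as a linear map. -/
noncomputable def opLin {d N : ℕ} (Pr : Matrix (Fin N) (Fin N) ℝ) (Γ : Fin N → Matrix (Fin d) (Fin d) ℝ) :
    (Fin N → Matrix (Fin d) (Fin d) ℝ) →ₗ[ℝ] (Fin N → Matrix (Fin d) (Fin d) ℝ) where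
  toFun := opL Pr Γ
  map_add' V W := by
    funext i
    simp [opL, opE, Finset.sum_add_distrib, mul_add, add_mul]
  map_smul' c V := by
    funext i
    simp [opL, opE, smul_comm _ c, ← Finset.smul_sum]

theorem opLin_apply {d N : ℕ} (Pr : Matrix (Fin N) (Fin N) ℝ)
    (Γ V : Fin N → Matrix (Fin d) (Fin d) ℝ) : opLin Pr Γ V = opL Pr Γ V := rfl

theorem opLin_pow {d N : ℕ} (Pr : Matrix (Fin N) (Fin N) ℝ)
    (Γ V : Fin N → Matrix (Fin d) (Fin d) ℝ) (t : ℕ) :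
    (opLin Pr Γ ^ t) V = (opL Pr Γ)^[t] V := by
  rw [Module.End.pow_apply]; rfl

theorem opL_sub {d N : ℕ} (Pr : Matrix (Fin N) (Fin N) ℝ)
    (Γ V W : Fin N → Matrix (Fin d) (Fin d) ℝ) :
    opL Pr Γ (V - W) = opL Pr Γ V - opL Pr Γ W := map_sub (opLin Pr Γ) V W

theorem opL_iter_sub {d N : ℕ} (Pr : Matrix (Fin N) (Fin N) ℝ)
    (Γ V W : Fin N → Matrix (Fin d) (Fin d) ℝ) (t : ℕ) :
    (opL Pr Γ)^[t] (V - W) = (opL Pr Γ)^[t] V - (opL Pr Γ)^[t] W := by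
  simp only [← opLin_pow, map_sub]

theorem telescope {d N : ℕ} (Pr : Matrix (Fin N) (Fin N) ℝ)
    (Γ D : Fin N → Matrix (Fin d) (Fin d) ℝ) (t : ℕ) :
    ∑ s ∈ Finset.range t, (opL Pr Γ)^[s] (D - opL Pr Γ D) = D - (opL Pr Γ)^[t] D := by
  induction t with
  | zero => simp
  | succ t ih =>
    rw [Finset.sum_range_succ, ih, opL_iter_sub, ← Function.iterate_succ_apply]
    abel

theorem hasSum_sol {d k N : ℕ} {Pr : Matrix (Fin N) (Fin N) ℝ}
    {A : Fin N → Matrix (Fin d) (Fin d) ℝ} {B : Fin N → Matrix (Fin d) (Fin k) ℝ}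
    {K : Fin N → Matrix (Fin k) (Fin d) ℝ} (h : MSS Pr A B K)
    (D : Fin N → Matrix (Fin d) (Fin d) ℝ) :
    HasSum (fun t : ℕ => (opL Pr (Gam A B K))^[t] (D - opL Pr (Gam A B K) D)) D := by
  have h1 := (h.summable (D - opL Pr (Gam A B K) D)).hasSum
  have h2 := h1.tendsto_sum_nat
  simp only [telescope] at h2
  have h3 := (h.summable D).tendsto_atTop_zero
  have h4 : Tendsto (fun t => D - (opL Pr (Gam A B K))^[t] D) atTop (𝓝 (D - 0)) :=
    tendsto_const_nhds.sub h3
  rw [sub_zero] at h4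
  rwa [tendsto_nhds_unique h2 h4] at h1

theorem exists_sol {d k N : ℕ} {Pr : Matrix (Fin N) (Fin N) ℝ}
    {A : Fin N → Matrix (Fin d) (Fin d) ℝ} {B : Fin N → Matrix (Fin d) (Fin k) ℝ}
    {K : Fin N → Matrix (Fin k) (Fin d) ℝ} (h : MSS Pr A B K)
    (G : Fin N → Matrix (Fin d) (Fin d) ℝ) :
    ∃ D, D - opL Pr (Gam A B K) D = G := by
  have hinj : Function.Injective
      (LinearMap.id (R := ℝ) (M := Fin N → Matrix (Fin d) (Fin d) ℝ) - opLin Pr (Gam A B K)) := by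
    rw [injective_iff_map_eq_zero]
    intro D hD
    have h1 := hasSum_sol h D
    have hD' : D - opL Pr (Gam A B K) D = 0 := hD
    simp only [hD', ← opLin_pow, map_zero] at h1
    exact h1.unique hasSum_zero
  obtain ⟨D, hD⟩ := LinearMap.injective_iff_surjective.1 hinj G
  exact ⟨D, hD⟩

theorem isClosed_psd (d : ℕ) : IsClosed {M : Matrix (Fin d) (Fin d) ℝ | M.PosSemidef} := by
  have : {M : Matrix (Fin d) (Fin d) ℝ | M.PosSemidef} =
      {M | Mᵀ = M} ∩ ⋂ x : Fin d → ℝ, {M | 0 ≤ x ⬝ᵥ (M *ᵥ x)} := by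
    ext M
    simp [Matrix.posSemidef_iff_dotProduct_mulVec, Matrix.IsHermitian,
      Matrix.conjTranspose_eq_transpose_of_trivial]
  rw [this]
  refine IsClosed.inter (isClosed_eq (by fun_prop) continuous_id) (isClosed_iInter fun x => ?_)
  refine isClosed_le continuous_const ?_
  exact Continuous.dotProduct continuous_const (Continuous.matrix_mulVec continuous_id continuous_const)

theorem psd_of_hasSum {d N : ℕ} {f : ℕ → Fin N → Matrix (Fin d) (Fin d) ℝ}
    {S : Fin N → Matrix (Fin d) (Fin d) ℝ} (h : HasSum f S) (hf : ∀ t i, (f t i).PosSemidef)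
    (i : Fin N) : (S i).PosSemidef := by
  have h1 := (tendsto_pi_nhds.1 h.tendsto_sum_nat) i
  refine (isClosed_psd d).mem_of_tendsto h1 (Eventually.of_forall fun t => ?_)
  simp only [Finset.sum_apply, Set.mem_ofPred_eq]
  exact Matrix.posSemidef_sum _ fun s _ => hf s i

theorem psd_conj {m n : ℕ} {M : Matrix (Fin m) (Fin m) ℝ} (h : M.PosSemidef)
    (G : Matrix (Fin m) (Fin n) ℝ) : (Gᵀ * M * G).PosSemidef := by
  simpa [Matrix.conjTranspose_eq_transpose_of_trivial] using h.conjTranspose_mul_mul_same G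

theorem psd_opE {d N : ℕ} {Pr : Matrix (Fin N) (Fin N) ℝ} (hPr : ∀ i j, 0 ≤ Pr i j)
    {V : Fin N → Matrix (Fin d) (Fin d) ℝ} (h : ∀ i, (V i).PosSemidef) (i : Fin N) :
    (opE Pr V i).PosSemidef :=
  Matrix.posSemidef_sum _ fun j _ => (h j).smul (hPr i j)

theorem psd_opL {d N : ℕ} {Pr : Matrix (Fin N) (Fin N) ℝ} (hPr : ∀ i j, 0 ≤ Pr i j)
    (Γ : Fin N → Matrix (Fin d) (Fin d) ℝ)
    {V : Fin N → Matrix (Fin d) (Fin d) ℝ} (h : ∀ i, (V i).PosSemidef) (i : Fin N) :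
    (opL Pr Γ V i).PosSemidef := psd_conj (psd_opE hPr h i) _

theorem psd_opL_iter {d N : ℕ} {Pr : Matrix (Fin N) (Fin N) ℝ} (hPr : ∀ i j, 0 ≤ Pr i j)
    (Γ : Fin N → Matrix (Fin d) (Fin d) ℝ)
    {V : Fin N → Matrix (Fin d) (Fin d) ℝ} (h : ∀ i, (V i).PosSemidef) (t : ℕ) :
    ∀ i, ((opL Pr Γ)^[t] V i).PosSemidef := by
  induction t with
  | zero => exact h
  | succ t ih => rw [Function.iterate_succ_apply']; exact psd_opL hPr Γ ih

theorem psd_opT {d N : ℕ} {Pr : Matrix (Fin N) (Fin N) ℝ} (hPr : ∀ i j, 0 ≤ Pr i j)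
    (Γ : Fin N → Matrix (Fin d) (Fin d) ℝ)
    {V : Fin N → Matrix (Fin d) (Fin d) ℝ} (h : ∀ i, (V i).PosSemidef) (j : Fin N) :
    (opT Pr Γ V j).PosSemidef :=
  Matrix.posSemidef_sum _ fun i _ => by
    have := (psd_conj (h i) (Γ i)ᵀ).smul (hPr i j)
    rwa [Matrix.transpose_transpose] at this

theorem psd_opT_iter {d N : ℕ} {Pr : Matrix (Fin N) (Fin N) ℝ} (hPr : ∀ i j, 0 ≤ Pr i j)
    (Γ : Fin N → Matrix (Fin d) (Fin d) ℝ)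
    {V : Fin N → Matrix (Fin d) (Fin d) ℝ} (h : ∀ i, (V i).PosSemidef) (t : ℕ) :
    ∀ i, ((opT Pr Γ)^[t] V i).PosSemidef := by
  induction t with
  | zero => exact h
  | succ t ih => rw [Function.iterate_succ_apply']; exact psd_opT hPr Γ ih

/-- A solution of `D - L(D) = G` with `G` positive semidefinite is positive semidefinite. -/
theorem psd_sol {d k N : ℕ} {Pr : Matrix (Fin N) (Fin N) ℝ} (hPr : ∀ i j, 0 ≤ Pr i j)
    {A : Fin N → Matrix (Fin d) (Fin d) ℝ} {B : Fin N → Matrix (Fin d) (Fin k) ℝ}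
    {K : Fin N → Matrix (Fin k) (Fin d) ℝ} (h : MSS Pr A B K)
    (D : Fin N → Matrix (Fin d) (Fin d) ℝ)
    (hG : ∀ i, ((D - opL Pr (Gam A B K) D) i).PosSemidef) (i : Fin N) : (D i).PosSemidef :=
  psd_of_hasSum (hasSum_sol h D) (fun t => psd_opL_iter hPr _ hG t) i

theorem trace_mul_nonneg' {d : ℕ} {V W : Matrix (Fin d) (Fin d) ℝ} (hV : V.PosSemidef)
    (hW : W.PosSemidef) : 0 ≤ (V * W).trace := by
  open scoped MatrixOrder in
  obtain ⟨a, rfl⟩ := CStarAlgebra.nonneg_iff_eq_star_mul_self.mp hV.nonneg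
  rw [mul_assoc, Matrix.trace_mul_comm]
  exact (hW.mul_mul_conjTranspose_same a).trace_nonneg

theorem psd_affine {d : ℕ} {M : Matrix (Fin d) (Fin d) ℝ} (hM : M.IsHermitian) (a b : ℝ)
    (hc : ∀ i, 0 ≤ a * hM.eigenvalues i + b) :
    (a • M + b • (1 : Matrix (Fin d) (Fin d) ℝ)).PosSemidef := by
  have h1 : M = (hM.eigenvectorUnitary : Matrix (Fin d) (Fin d) ℝ) *
      diagonal hM.eigenvalues * (hM.eigenvectorUnitary : Matrix (Fin d) (Fin d) ℝ)ᴴ := by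
    have := hM.spectral_theorem
    rw [Unitary.conjStarAlgAut_apply] at this
    exact this
  have h2 : (hM.eigenvectorUnitary : Matrix (Fin d) (Fin d) ℝ) *
      (hM.eigenvectorUnitary : Matrix (Fin d) (Fin d) ℝ)ᴴ = 1 :=
    Unitary.coe_mul_star_self hM.eigenvectorUnitary
  have h3 : a • M + b • (1 : Matrix (Fin d) (Fin d) ℝ) =
      (hM.eigenvectorUnitary : Matrix (Fin d) (Fin d) ℝ) *
      (diagonal (fun i => a * hM.eigenvalues i + b)) *
        (hM.eigenvectorUnitary : Matrix (Fin d) (Fin d) ℝ)ᴴ := by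
    have : (diagonal (fun i => a * hM.eigenvalues i + b)) =
        a • diagonal hM.eigenvalues + b • (1 : Matrix (Fin d) (Fin d) ℝ) := by
      rw [Matrix.smul_one_eq_diagonal, ← Matrix.diagonal_smul, Matrix.diagonal_add]
      rfl
    rw [this, mul_add, add_mul, Matrix.mul_smul, Matrix.smul_mul, ← h1, Matrix.mul_smul,
      Matrix.smul_mul, mul_one, h2]
  rw [h3]
  refine (Matrix.PosSemidef.diagonal fun i => ?_).mul_mul_conjTranspose_same _
  exact hc i

theorem psd_sub_smul_one {d : ℕ} {M : Matrix (Fin d) (Fin d) ℝ} (hM : M.IsHermitian) (c : ℝ)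
    (hc : ∀ i, c ≤ hM.eigenvalues i) : (M - c • (1 : Matrix (Fin d) (Fin d) ℝ)).PosSemidef := by
  have := psd_affine hM 1 (-c) (fun i => by linarith [hc i])
  rwa [one_smul, neg_smul, ← sub_eq_add_neg] at this

theorem psd_smul_one_sub {d : ℕ} {M : Matrix (Fin d) (Fin d) ℝ} (hM : M.IsHermitian) (c : ℝ)
    (hc : ∀ i, hM.eigenvalues i ≤ c) : (c • (1 : Matrix (Fin d) (Fin d) ℝ) - M).PosSemidef := by
  have := psd_affine hM (-1) c (fun i => by linarith [hc i])
  rwa [neg_smul, one_smul, neg_add_eq_sub] at this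

theorem posDef_lower {d : ℕ} {M : Matrix (Fin d) (Fin d) ℝ} (hM : M.PosDef) :
    ∃ ε : ℝ, 0 < ε ∧ (M - ε • (1 : Matrix (Fin d) (Fin d) ℝ)).PosSemidef := by
  rcases Nat.eq_zero_or_pos d with rfl | hd
  · refine ⟨1, one_pos, psd_sub_smul_one hM.1 1 (fun i => i.elim0)⟩
  · have : Nonempty (Fin d) := ⟨⟨0, hd⟩⟩
    obtain ⟨i0, hi0⟩ := Finite.exists_min hM.1.eigenvalues
    exact ⟨_, hM.eigenvalues_pos i0, psd_sub_smul_one hM.1 _ hi0⟩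

theorem psd_quad {d : ℕ} {M : Matrix (Fin d) (Fin d) ℝ} (h : M.PosSemidef) (x : Fin d → ℝ) :
    0 ≤ x ⬝ᵥ (M *ᵥ x) := by simpa using h.dotProduct_mulVec_nonneg x

theorem opL_quad {d N : ℕ} (Pr : Matrix (Fin N) (Fin N) ℝ)
    (Γ V : Fin N → Matrix (Fin d) (Fin d) ℝ) (i : Fin N) (x y : Fin d → ℝ) :
    x ⬝ᵥ (opL Pr Γ V i *ᵥ y) = ∑ j, Pr i j * ((Γ i *ᵥ x) ⬝ᵥ (V j *ᵥ (Γ i *ᵥ y))) := by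
  simp only [opL, opE, ← Matrix.mulVec_mulVec, Matrix.dotProduct_mulVec _ (Γ i)ᵀ, Matrix.vecMul_transpose,
    Matrix.sum_mulVec, dotProduct_sum, Matrix.smul_mulVec, dotProduct_smul, smul_eq_mul]

theorem bound_iter {d N : ℕ} {Pr : Matrix (Fin N) (Fin N) ℝ} (hPr : ∀ i j, 0 ≤ Pr i j)
    (Γ V W : Fin N → Matrix (Fin d) (Fin d) ℝ) (c : ℝ)
    (h : ∀ i x y, |x ⬝ᵥ (V i *ᵥ y)| ≤ c * (x ⬝ᵥ (W i *ᵥ x) + y ⬝ᵥ (W i *ᵥ y))) (t : ℕ) :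
    ∀ i x y, |x ⬝ᵥ ((opL Pr Γ)^[t] V i *ᵥ y)| ≤
      c * (x ⬝ᵥ ((opL Pr Γ)^[t] W i *ᵥ x) + y ⬝ᵥ ((opL Pr Γ)^[t] W i *ᵥ y)) := by
  induction t with
  | zero => exact h
  | succ t ih =>
    intro i x y
    simp only [Function.iterate_succ_apply', opL_quad]
    refine (Finset.abs_sum_le_sum_abs _ _).trans ?_
    rw [← Finset.sum_add_distrib, Finset.mul_sum]
    refine Finset.sum_le_sum fun j _ => ?_
    rw [abs_mul, abs_of_nonneg (hPr i j)]
    have := mul_le_mul_of_nonneg_left (ih j (Γ i *ᵥ x) (Γ i *ᵥ y)) (hPr i j)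
    linarith

theorem exists_bound {d : ℕ} (V : Matrix (Fin d) (Fin d) ℝ) {M : Matrix (Fin d) (Fin d) ℝ}
    (hM : M.PosDef) : ∃ c, 0 ≤ c ∧ ∀ x y, |x ⬝ᵥ (V *ᵥ y)| ≤ c * (x ⬝ᵥ (M *ᵥ x) + y ⬝ᵥ (M *ᵥ y)) := by
  obtain ⟨ε, hε, hp⟩ := posDef_lower hM
  have hq : ∀ x, x ⬝ᵥ x ≤ ε⁻¹ * (x ⬝ᵥ (M *ᵥ x)) := by
    intro x
    have := psd_quad hp x
    rw [Matrix.sub_mulVec, dotProduct_sub, Matrix.smul_mulVec, Matrix.one_mulVec, dotProduct_smul,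
      smul_eq_mul] at this
    rw [inv_mul_eq_div, le_div_iff₀ hε]
    linarith
  have hsq : ∀ (x : Fin d → ℝ) a, x a ^ 2 ≤ x ⬝ᵥ x := by
    intro x a
    have := Finset.single_le_sum (f := fun a => x a * x a) (s := Finset.univ) (fun a _ => mul_self_nonneg (x a)) (Finset.mem_univ a)
    rw [sq]; exact this
  refine ⟨(∑ a, ∑ b, |V a b|) * ε⁻¹, by positivity, fun x y => ?_⟩
  have h1 : |x ⬝ᵥ (V *ᵥ y)| ≤ (∑ a, ∑ b, |V a b|) * (x ⬝ᵥ x + y ⬝ᵥ y) := by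
    simp only [dotProduct, Matrix.mulVec, Finset.mul_sum]
    refine (Finset.abs_sum_le_sum_abs _ _).trans ?_
    rw [Finset.sum_mul]
    refine Finset.sum_le_sum fun a _ => ?_
    refine (Finset.abs_sum_le_sum_abs _ _).trans ?_
    rw [Finset.sum_mul]
    refine Finset.sum_le_sum fun b _ => ?_
    have e1 := hsq x a
    have e2 := hsq y b
    have e3 : |x a| * |y b| ≤ x ⬝ᵥ x + y ⬝ᵥ y := by
      have := sq_nonneg (|x a| - |y b|)
      have h1 := sq_abs (x a)
      have h2 := sq_abs (y b)
      nlinarith [sq_nonneg (x a), sq_nonneg (y b)]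
    rw [abs_mul, abs_mul]
    calc _ = |V a b| * (|x a| * |y b|) := by ring
      _ ≤ _ := mul_le_mul_of_nonneg_left e3 (abs_nonneg _)
  refine h1.trans ?_
  have h5 : x ⬝ᵥ x + y ⬝ᵥ y ≤ ε⁻¹ * (x ⬝ᵥ (M *ᵥ x) + y ⬝ᵥ (M *ᵥ y)) := by
    rw [mul_add]
    exact add_le_add (hq x) (hq y)
  have h6 : (0:ℝ) ≤ ∑ a, ∑ b, |V a b| := by positivity
  rw [mul_assoc]
  exact mul_le_mul_of_nonneg_left h5 h6

theorem mss_of_lyap {d k N : ℕ} {Pr : Matrix (Fin N) (Fin N) ℝ} (hPr : ∀ i j, 0 ≤ Pr i j)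
    {A : Fin N → Matrix (Fin d) (Fin d) ℝ} {B : Fin N → Matrix (Fin d) (Fin k) ℝ}
    {K : Fin N → Matrix (Fin k) (Fin d) ℝ} {Q P : Fin N → Matrix (Fin d) (Fin d) ℝ}
    (hQ : ∀ i, (Q i).PosDef) (hP : ∀ i, (P i).PosSemidef)
    (h : ∀ i, ((P - opL Pr (Gam A B K) P - Q) i).PosSemidef) : MSS Pr A B K := by
  set Γ := Gam A B K with hΓ
  have hzero : ∀ (i : Fin N) (x : Fin d → ℝ), Tendsto (fun t : ℕ => x ⬝ᵥ ((opL Pr Γ)^[t] Q i *ᵥ x)) atTop (𝓝 (0 : ℝ)) := by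
    intro i x
    have hs : Summable (fun t : ℕ => x ⬝ᵥ ((opL Pr Γ)^[t] Q i *ᵥ x)) := by
      refine summable_of_sum_range_le (c := x ⬝ᵥ (P i *ᵥ x))
        (fun t => psd_quad (psd_opL_iter hPr Γ (fun i => (hQ i).posSemidef) t i) x) fun t => ?_
      have h1 : ∀ s, x ⬝ᵥ ((opL Pr Γ)^[s] Q i *ᵥ x) ≤ x ⬝ᵥ ((opL Pr Γ)^[s] (P - opL Pr Γ P) i *ᵥ x) := by
        intro s
        have := psd_quad (psd_opL_iter hPr Γ h s i) x
        rw [opL_iter_sub, Pi.sub_apply, Matrix.sub_mulVec, dotProduct_sub] at this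
        linarith
      refine (Finset.sum_le_sum fun s _ => h1 s).trans ?_
      have h2 : ∑ s ∈ Finset.range t, x ⬝ᵥ ((opL Pr Γ)^[s] (P - opL Pr Γ P) i *ᵥ x) =
          x ⬝ᵥ ((∑ s ∈ Finset.range t, (opL Pr Γ)^[s] (P - opL Pr Γ P)) i *ᵥ x) := by
        rw [Finset.sum_apply, Matrix.sum_mulVec, dotProduct_sum]
      rw [h2, telescope, Pi.sub_apply, Matrix.sub_mulVec, dotProduct_sub]
      have := psd_quad (psd_opL_iter hPr Γ hP t i) x
      linarith
    exact hs.tendsto_atTop_zero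
  refine MSS.of_tendsto fun V i a b => ?_
  choose c hc0 hc using fun i => exists_bound (V i) (hQ i)
  have hb : ∀ i x y, |x ⬝ᵥ (V i *ᵥ y)| ≤ (∑ i, c i) * (x ⬝ᵥ (Q i *ᵥ x) + y ⬝ᵥ (Q i *ᵥ y)) := by
    intro i x y
    refine (hc i x y).trans (mul_le_mul_of_nonneg_right
      (Finset.single_le_sum (fun i _ => hc0 i) (Finset.mem_univ i)) ?_)
    exact add_nonneg (psd_quad (hQ i).posSemidef x) (psd_quad (hQ i).posSemidef y)
  have hb2 := fun t => bound_iter hPr Γ V Q _ hb t i (Pi.single a 1) (Pi.single b 1)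
  have hl := ((hzero i (Pi.single a 1)).add (hzero i (Pi.single b 1))).const_mul (∑ i, c i)
  simp only [add_zero, mul_zero] at hl
  refine squeeze_zero_norm (fun t => ?_) hl
  have := hb2 t
  simpa using this

theorem duality {d N : ℕ} (Pr : Matrix (Fin N) (Fin N) ℝ)
    (Γ V X : Fin N → Matrix (Fin d) (Fin d) ℝ) :
    ∑ i, (opL Pr Γ V i * X i).trace = ∑ j, (V j * opT Pr Γ X j).trace := by
  simp only [opL, opE, opT, Finset.mul_sum, Finset.sum_mul, Matrix.trace_sum, Matrix.mul_smul,
    Matrix.smul_mul, Matrix.trace_smul]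
  rw [Finset.sum_comm]
  refine Finset.sum_congr rfl fun j _ => Finset.sum_congr rfl fun i _ => ?_
  congr 1
  rw [mul_assoc, mul_assoc, Matrix.trace_mul_comm]
  simp only [mul_assoc]

theorem duality_iter {d N : ℕ} (Pr : Matrix (Fin N) (Fin N) ℝ)
    (Γ V X : Fin N → Matrix (Fin d) (Fin d) ℝ) (t : ℕ) :
    ∑ i, ((opL Pr Γ)^[t] V i * X i).trace = ∑ j, (V j * (opT Pr Γ)^[t] X j).trace := by
  induction t generalizing V with
  | zero => rfl
  | succ t ih => rw [Function.iterate_succ_apply, ih, duality, Function.iterate_succ_apply']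

theorem opT_summable {d k N : ℕ} {Pr : Matrix (Fin N) (Fin N) ℝ}
    {A : Fin N → Matrix (Fin d) (Fin d) ℝ} {B : Fin N → Matrix (Fin d) (Fin k) ℝ}
    {K : Fin N → Matrix (Fin k) (Fin d) ℝ} (h : MSS Pr A B K)
    (X : Fin N → Matrix (Fin d) (Fin d) ℝ) :
    Summable (fun t : ℕ => (opT Pr (Gam A B K))^[t] X) := by
  have hent : ∀ j a b, Summable (fun t : ℕ => (opT Pr (Gam A B K))^[t] X j a b) := by
    intro j a b
    have h1 : ∀ t : ℕ, (opT Pr (Gam A B K))^[t] X j a b =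
        ∑ i, ((opL Pr (Gam A B K))^[t] (Pi.single j (Matrix.single b a 1)) i * X i).trace := by
      intro t
      rw [duality_iter, Finset.sum_eq_single j]
      · simp [Matrix.trace_single_mul]
      · intro i _ hi
        simp [hi]
      · simp
    simp only [h1]
    refine summable_sum fun i _ => ?_
    have h2 := Pi.summable.1 (h.summable (Pi.single j (Matrix.single b a 1))) i
    exact h2.map ((Matrix.traceAddMonoidHom (Fin d) ℝ).comp (AddMonoidHom.mulRight (X i)))
      (Continuous.matrix_trace (Continuous.matrix_mul continuous_id continuous_const))
  rw [Pi.summable]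
  intro j
  have : Summable (fun t : ℕ => ((fun a b => (opT Pr (Gam A B K))^[t] X j a b) : Fin d → Fin d → ℝ)) := by
    rw [Pi.summable]; intro a
    rw [Pi.summable]; intro b
    exact hent j a b
  exact this

theorem continuous_opT {d N : ℕ} (Pr : Matrix (Fin N) (Fin N) ℝ)
    (Γ : Fin N → Matrix (Fin d) (Fin d) ℝ) : Continuous (opT Pr Γ) := by
  refine continuous_pi fun j => continuous_finsetSum _ fun i _ => ?_
  refine Continuous.const_smul (g := fun a : Fin N → Matrix (Fin d) (Fin d) ℝ =>
    Γ i * a i * (Γ i)ᵀ) ?_ (Pr i j)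
  exact ((continuous_const.matrix_mul (continuous_apply i)).matrix_mul continuous_const)

/-- The operator `opT` as an additive map. -/
noncomputable def opTAdd {d N : ℕ} (Pr : Matrix (Fin N) (Fin N) ℝ) (Γ : Fin N → Matrix (Fin d) (Fin d) ℝ) :
    (Fin N → Matrix (Fin d) (Fin d) ℝ) →+ (Fin N → Matrix (Fin d) (Fin d) ℝ) where
  toFun := opT Pr Γ
  map_zero' := by
    funext i
    simp [opT]
  map_add' V W := by
    funext i
    simp [opT, Finset.sum_add_distrib, mul_add, add_mul]

theorem opT_fix {d k N : ℕ} {Pr : Matrix (Fin N) (Fin N) ℝ}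
    {A : Fin N → Matrix (Fin d) (Fin d) ℝ} {B : Fin N → Matrix (Fin d) (Fin k) ℝ}
    {K : Fin N → Matrix (Fin k) (Fin d) ℝ} (h : MSS Pr A B K) (piv : Fin N → ℝ)
    (Sg : Matrix (Fin d) (Fin d) ℝ) :
    XK Pr piv Sg (Gam A B K) =
      (fun i => piv i • Sg) + opT Pr (Gam A B K) (XK Pr piv Sg (Gam A B K)) := by
  have h1 := (opT_summable h (fun i => piv i • Sg)).hasSum
  have h2 := h1.map (opTAdd Pr (Gam A B K)) (continuous_opT Pr (Gam A B K))
  have h3 := (opT_summable h (fun i => piv i • Sg)).tsum_eq_zero_add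
  have h4 : HasSum (fun t : ℕ => (opT Pr (Gam A B K))^[t + 1] (fun i => piv i • Sg))
      (opT Pr (Gam A B K) (∑' t : ℕ, (opT Pr (Gam A B K))^[t] (fun i => piv i • Sg))) := by
    convert! h2 using 2
    rw [Function.iterate_succ_apply']
    rfl
  rw [h4.tsum_eq] at h3
  exact h3

theorem norm_eig {d : ℕ} {M : Matrix (Fin d) (Fin d) ℝ} (hM : M.IsHermitian) (i : Fin d) :
    ‖Matrix.toEuclideanLin M (hM.eigenvectorBasis i)‖ = |hM.eigenvalues i| := by
  have h1 : Matrix.toEuclideanLin M (hM.eigenvectorBasis i) =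
      hM.eigenvalues i • hM.eigenvectorBasis i := by
    ext a
    have := congrFun (hM.mulVec_eigenvectorBasis i) a
    simpa [Matrix.toEuclideanLin] using this
  rw [h1, norm_smul, hM.eigenvectorBasis.orthonormal.1 i]
  simp

theorem sigmaMin_nonneg {d : ℕ} (M : Matrix (Fin d) (Fin d) ℝ) : 0 ≤ sigmaMin M :=
  Real.iInf_nonneg fun _ => norm_nonneg _

theorem psd_sigmaMin {d : ℕ} {M : Matrix (Fin d) (Fin d) ℝ} (hM : M.PosDef) :
    (M - sigmaMin M • (1 : Matrix (Fin d) (Fin d) ℝ)).PosSemidef := by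
  refine psd_sub_smul_one hM.1 _ fun i => ?_
  have h1 := norm_eig hM.1 i
  rw [abs_of_pos (hM.eigenvalues_pos i)] at h1
  rw [← h1]
  exact ciInf_le (f := fun x : {x : EuclideanSpace ℝ (Fin d) // ‖x‖ = 1} =>
    ‖Matrix.toEuclideanLin M x.1‖) ⟨0, by rintro _ ⟨x, rfl⟩; exact norm_nonneg _⟩
    ⟨hM.1.eigenvectorBasis i, hM.1.eigenvectorBasis.orthonormal.1 i⟩

theorem psd_specNorm {d : ℕ} {M : Matrix (Fin d) (Fin d) ℝ} (hM : M.IsHermitian) :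
    (specNorm M • (1 : Matrix (Fin d) (Fin d) ℝ) - M).PosSemidef := by
  refine psd_smul_one_sub hM _ fun i => ?_
  refine (le_abs_self _).trans ?_
  rw [← norm_eig hM i]
  refine le_ciSup (f := fun x : {x : EuclideanSpace ℝ (Fin d) // ‖x‖ ≤ 1} =>
    ‖Matrix.toEuclideanLin M x.1‖) ?_
    ⟨hM.eigenvectorBasis i, (hM.eigenvectorBasis.orthonormal.1 i).le⟩
  refine ⟨‖(Matrix.toEuclideanLin M).toContinuousLinearMap‖, ?_⟩
  rintro _ ⟨x, rfl⟩
  exact (Matrix.toEuclideanLin M).toContinuousLinearMap.unit_le_opNorm x.1 x.2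

theorem psd_maxNorm {d N : ℕ} {X : Fin N → Matrix (Fin d) (Fin d) ℝ}
    (hX : ∀ i, (X i).PosSemidef) (i : Fin N) :
    (maxNorm X • (1 : Matrix (Fin d) (Fin d) ℝ) - X i).PosSemidef := by
  have h1 : specNorm (X i) ≤ maxNorm X :=
    le_ciSup (f := fun i => specNorm (X i)) (Set.finite_range _).bddAbove i
  have h2 := (psd_specNorm (hX i).1).add
    ((Matrix.PosSemidef.one (n := Fin d) (R := ℝ)).smul (sub_nonneg.2 h1))
  have h3 : maxNorm X • (1 : Matrix (Fin d) (Fin d) ℝ) - X i =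
      specNorm (X i) • (1 : Matrix (Fin d) (Fin d) ℝ) - X i
        + (maxNorm X - specNorm (X i)) • (1 : Matrix (Fin d) (Fin d) ℝ) := by
    rw [sub_smul]; abel
  rw [h3]; exact h2

theorem psd_mu {d N : ℕ} {piv : Fin N → ℝ} (hpiv : ∀ i, 0 < piv i)
    {Sg : Matrix (Fin d) (Fin d) ℝ} (hSg : Sg.PosDef) (i : Fin N) :
    (piv i • Sg - mu piv Sg • (1 : Matrix (Fin d) (Fin d) ℝ)).PosSemidef := by
  have h1 : (⨅ i, piv i) ≤ piv i := ciInf_le (Set.finite_range _).bddBelow i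
  have h2 : 0 ≤ (piv i - ⨅ i, piv i) * sigmaMin Sg :=
    mul_nonneg (sub_nonneg.2 h1) (sigmaMin_nonneg _)
  have h3 := ((psd_sigmaMin hSg).smul (hpiv i).le).add
    ((Matrix.PosSemidef.one (n := Fin d) (R := ℝ)).smul h2)
  convert! h3 using 1
  simp only [mu, smul_sub, smul_smul, sub_mul, sub_smul]
  abel

theorem lyap_PK {d k N : ℕ} {Pr : Matrix (Fin N) (Fin N) ℝ}
    {A : Fin N → Matrix (Fin d) (Fin d) ℝ} {B : Fin N → Matrix (Fin d) (Fin k) ℝ}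
    {K : Fin N → Matrix (Fin k) (Fin d) ℝ} (h : MSS Pr A B K)
    (Q : Fin N → Matrix (Fin d) (Fin d) ℝ) (R : Fin N → Matrix (Fin k) (Fin k) ℝ) :
    PK Pr A B Q R K - opL Pr (Gam A B K) (PK Pr A B Q R K) =
      fun i => Q i + (K i)ᵀ * R i * K i := by
  have hex : ∃ P, IsLyap Pr A B Q R K P := by
    obtain ⟨D, hD⟩ := exists_sol h (fun i => Q i + (K i)ᵀ * R i * K i)
    refine ⟨D, fun i => ?_⟩
    have := congrFun hD i
    rw [Pi.sub_apply, sub_eq_iff_eq_add] at this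
    exact this
  have h1 : IsLyap Pr A B Q R K (PK Pr A B Q R K) := by
    unfold PK
    rw [dif_pos hex]
    exact hex.choose_spec
  funext i
  rw [Pi.sub_apply, sub_eq_iff_eq_add]
  exact h1 i

theorem psd_PK {d k N : ℕ} {Pr : Matrix (Fin N) (Fin N) ℝ} (hPr : ∀ i j, 0 ≤ Pr i j)
    {A : Fin N → Matrix (Fin d) (Fin d) ℝ} {B : Fin N → Matrix (Fin d) (Fin k) ℝ}
    {K : Fin N → Matrix (Fin k) (Fin d) ℝ} (h : MSS Pr A B K)
    {Q : Fin N → Matrix (Fin d) (Fin d) ℝ} {R : Fin N → Matrix (Fin k) (Fin k) ℝ}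
    (hQ : ∀ i, (Q i).PosDef) (hR : ∀ i, (R i).PosDef) (i : Fin N) :
    (PK Pr A B Q R K i).PosSemidef := by
  refine psd_sol hPr h _ (fun i => ?_) i
  rw [lyap_PK h]
  exact (hQ i).posSemidef.add (psd_conj (hR i).posSemidef _)

theorem complete_square {d k : ℕ} (A E : Matrix (Fin d) (Fin d) ℝ) (B : Matrix (Fin d) (Fin k) ℝ)
    (R : Matrix (Fin k) (Fin k) ℝ) (K D : Matrix (Fin k) (Fin d) ℝ) (hE : Eᵀ = E) (hR : Rᵀ = R) :
    (K + D)ᵀ * R * (K + D) + (A - B * (K + D))ᵀ * E * (A - B * (K + D)) =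
      Kᵀ * R * K + (A - B * K)ᵀ * E * (A - B * K) +
      (Dᵀ * ((R + Bᵀ * E * B) * K - Bᵀ * E * A) + ((R + Bᵀ * E * B) * K - Bᵀ * E * A)ᵀ * D
        + Dᵀ * (R + Bᵀ * E * B) * D) := by
  simp only [Matrix.transpose_add, Matrix.transpose_sub, Matrix.transpose_mul,
    Matrix.transpose_transpose, hE, hR, Matrix.mul_add, Matrix.add_mul, Matrix.mul_sub,
    Matrix.sub_mul, Matrix.mul_assoc]
  abel

/-- Performance difference: the Lyapunov residual of `P^K` under another policy. -/
theorem perf_diff {d k N : ℕ} {Pr : Matrix (Fin N) (Fin N) ℝ} (hPr : ∀ i j, 0 ≤ Pr i j)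
    {A : Fin N → Matrix (Fin d) (Fin d) ℝ} {B : Fin N → Matrix (Fin d) (Fin k) ℝ}
    {K : Fin N → Matrix (Fin k) (Fin d) ℝ} (h : MSS Pr A B K)
    {Q : Fin N → Matrix (Fin d) (Fin d) ℝ} {R : Fin N → Matrix (Fin k) (Fin k) ℝ}
    (hQ : ∀ i, (Q i).PosDef) (hR : ∀ i, (R i).PosDef) (K' : Fin N → Matrix (Fin k) (Fin d) ℝ)
    (i : Fin N) :
    (PK Pr A B Q R K - opL Pr (Gam A B K') (PK Pr A B Q R K)) i =
      Q i + (K' i)ᵀ * R i * K' i -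
      ((K' i - K i)ᵀ * LK Pr A B Q R K i + (LK Pr A B Q R K i)ᵀ * (K' i - K i)
        + (K' i - K i)ᵀ * (R i + (B i)ᵀ * opE Pr (PK Pr A B Q R K) i * B i) * (K' i - K i)) := by
  have hE : (opE Pr (PK Pr A B Q R K) i)ᵀ = opE Pr (PK Pr A B Q R K) i := by
    have := (psd_opE hPr (psd_PK hPr h hQ hR) i).1
    rwa [Matrix.IsHermitian, Matrix.conjTranspose_eq_transpose_of_trivial] at this
  have hRt : (R i)ᵀ = R i := by
    have := (hR i).1
    rwa [Matrix.IsHermitian, Matrix.conjTranspose_eq_transpose_of_trivial] at this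
  have h1 := complete_square (A i) (opE Pr (PK Pr A B Q R K) i) (B i) (R i) (K i) (K' i - K i) hE hRt
  rw [add_sub_cancel] at h1
  have h2 := congrFun (lyap_PK h Q R) i
  rw [Pi.sub_apply, sub_eq_iff_eq_add] at h2
  simp only [opL, Gam] at h2
  simp only [Pi.sub_apply, opL, Gam, LK]
  rw [← sub_eq_iff_eq_add'] at h1
  rw [← h1]
  generalize PK Pr A B Q R K i = a at h2 ⊢
  rw [h2]
  abel

/-- One Gauss-Newton step. -/
theorem gn_step {d k N : ℕ} (hd : 0 < d) (hN : 0 < N)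
    (A : Fin N → Matrix (Fin d) (Fin d) ℝ) (B : Fin N → Matrix (Fin d) (Fin k) ℝ)
    (Pr : Matrix (Fin N) (Fin N) ℝ) (hPr : ∀ i j, 0 ≤ Pr i j)
    (piv : Fin N → ℝ) (hpiv : ∀ i, 0 < piv i)
    (Sg : Matrix (Fin d) (Fin d) ℝ) (hSg : Sg.PosDef)
    (Q : Fin N → Matrix (Fin d) (Fin d) ℝ) (hQ : ∀ i, (Q i).PosDef)
    (R : Fin N → Matrix (Fin k) (Fin k) ℝ) (hR : ∀ i, (R i).PosDef)
    (η : ℝ) (hη0 : 0 < η) (hη : η ≤ 1 / 2)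
    (Ks : Fin N → Matrix (Fin k) (Fin d) ℝ) (hKs : MSS Pr A B Ks)
    (K K' : Fin N → Matrix (Fin k) (Fin d) ℝ) (hK : MSS Pr A B K)
    (hK' : K' = fun i => K i
      - (2 * η) • ((R i + (B i)ᵀ * opE Pr (PK Pr A B Q R K) i * B i)⁻¹
          * LK Pr A B Q R K i)) :
    MSS Pr A B K' ∧
      0 ≤ 1 - 2 * mu piv Sg * η / maxNorm (XK Pr piv Sg (Gam A B Ks)) ∧
      cost Pr A B Q R piv Sg K' - cost Pr A B Q R piv Sg Ks
        ≤ (1 - 2 * mu piv Sg * η / maxNorm (XK Pr piv Sg (Gam A B Ks)))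
            * (cost Pr A B Q R piv Sg K - cost Pr A B Q R piv Sg Ks) := by
  set P := PK Pr A B Q R K with hPdef
  set L := LK Pr A B Q R K with hLdef
  set X := XK Pr piv Sg (Gam A B Ks) with hXdef
  obtain ⟨S, hSdef⟩ : ∃ S : Fin N → Matrix (Fin k) (Fin k) ℝ,
    S = fun i => R i + (B i)ᵀ * opE Pr P i * B i := ⟨_, rfl⟩
  have hSi : ∀ i, R i + (B i)ᵀ * opE Pr P i * B i = S i := fun i => by rw [hSdef]
  simp only [hSi] at hK'
  have hP : ∀ i, (P i).PosSemidef := psd_PK hPr hK hQ hR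
  have hS : ∀ i, (S i).PosDef := fun i => by
    rw [hSdef]; exact (hR i).add_posSemidef (psd_conj (psd_opE hPr hP i) _)
  have hSt : ∀ i, (S i)ᵀ = S i := fun i => by
    have := (hS i).1
    rwa [Matrix.IsHermitian, Matrix.conjTranspose_eq_transpose_of_trivial] at this
  have hSu : ∀ i, IsUnit (S i).det := fun i => (Matrix.isUnit_iff_isUnit_det _).1 (hS i).isUnit
  have hSit : ∀ i, ((S i)⁻¹)ᵀ = (S i)⁻¹ := fun i => by
    rw [Matrix.transpose_nonsing_inv, hSt]
  obtain ⟨W, hWdef⟩ : ∃ W : Fin N → Matrix (Fin d) (Fin d) ℝ,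
    W = fun i => (L i)ᵀ * (S i)⁻¹ * L i := ⟨_, rfl⟩
  have hWi : ∀ i, W i = (L i)ᵀ * (S i)⁻¹ * L i := fun i => by rw [hWdef]
  have hW : ∀ i, (W i).PosSemidef := fun i => by
    rw [hWi]; exact psd_conj (hS i).inv.posSemidef _
  have hpd : ∀ (K1 : Fin N → Matrix (Fin k) (Fin d) ℝ) i,
      (P - opL Pr (Gam A B K1) P) i = Q i + (K1 i)ᵀ * R i * K1 i -
      ((K1 i - K i)ᵀ * L i + (L i)ᵀ * (K1 i - K i) + (K1 i - K i)ᵀ * S i * (K1 i - K i)) := by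
    intro K1 i
    rw [hPdef, perf_diff hPr hK hQ hR K1 i, ← hPdef, hSi]
  -- completing the square
  have hsq : ∀ (D : Matrix (Fin k) (Fin d) ℝ) i,
      W i + (Dᵀ * L i + (L i)ᵀ * D + Dᵀ * S i * D) =
        ((S i)⁻¹ * L i + D)ᵀ * S i * ((S i)⁻¹ * L i + D) := by
    intro D i
    have e1 : S i * ((S i)⁻¹ * L i) = L i := by
      rw [← Matrix.mul_assoc, Matrix.mul_nonsing_inv _ (hSu i), Matrix.one_mul]
    have e2 : (S i)⁻¹ * (S i * D) = D := by
      rw [← Matrix.mul_assoc, Matrix.nonsing_inv_mul _ (hSu i), Matrix.one_mul]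
    simp only [hWi, Matrix.transpose_add, Matrix.transpose_mul, hSit, Matrix.mul_add,
      Matrix.add_mul, Matrix.mul_assoc, e1, e2]
    abel
  have hgn : ∀ i, (K' i - K i)ᵀ * L i + (L i)ᵀ * (K' i - K i) + (K' i - K i)ᵀ * S i * (K' i - K i)
      = -((4 * η * (1 - η)) • W i) := by
    intro i
    have e0 : K' i - K i = -((2 * η) • ((S i)⁻¹ * L i)) := by
      rw [hK']; simp
    have e1 : S i * ((S i)⁻¹ * L i) = L i := by
      rw [← Matrix.mul_assoc, Matrix.mul_nonsing_inv _ (hSu i), Matrix.one_mul]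
    rw [e0]
    simp only [hWi, Matrix.transpose_neg, Matrix.transpose_smul, Matrix.transpose_mul, hSit,
      Matrix.neg_mul, Matrix.mul_neg, Matrix.smul_mul, Matrix.mul_smul, Matrix.mul_assoc, e1]
    module
  have hη1 : 0 ≤ 4 * η * (1 - η) := by nlinarith
  have hstab : MSS Pr A B K' := by
    refine mss_of_lyap hPr hQ hP fun i => ?_
    rw [Pi.sub_apply, hpd, hgn]
    have e : Q i + (K' i)ᵀ * R i * K' i - -((4 * η * (1 - η)) • W i) - Q i =
      (K' i)ᵀ * R i * K' i + (4 * η * (1 - η)) • W i := by abel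
    rw [e]
    exact (psd_conj (hR i).posSemidef _).add ((hW i).smul hη1)
  -- cost decrease
  have hmu : ∀ i, (piv i • Sg - mu piv Sg • (1 : Matrix (Fin d) (Fin d) ℝ)).PosSemidef :=
    psd_mu hpiv hSg
  have hmu0 : 0 ≤ mu piv Sg :=
    mul_nonneg (Real.iInf_nonneg fun i => (hpiv i).le) (sigmaMin_nonneg _)
  have hcost : ∀ K1 K2 : Fin N → Matrix (Fin k) (Fin d) ℝ,
      cost Pr A B Q R piv Sg K1 - cost Pr A B Q R piv Sg K2 =
        ∑ i, ((PK Pr A B Q R K1 - PK Pr A B Q R K2) i * (piv i • Sg)).trace := by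
    intro K1 K2
    simp only [cost, ← Finset.sum_sub_distrib]
    refine Finset.sum_congr rfl fun i _ => ?_
    rw [Pi.sub_apply, Matrix.sub_mul, Matrix.trace_sub, Matrix.mul_smul, Matrix.mul_smul,
      Matrix.trace_smul, Matrix.trace_smul, smul_eq_mul, smul_eq_mul]
  have hres : ∀ K1, MSS Pr A B K1 → ∀ i,
      (P - PK Pr A B Q R K1 - opL Pr (Gam A B K1) (P - PK Pr A B Q R K1)) i =
      -((K1 i - K i)ᵀ * L i + (L i)ᵀ * (K1 i - K i) + (K1 i - K i)ᵀ * S i * (K1 i - K i)) := by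
    intro K1 h1 i
    have e1 := hpd K1 i
    have e2 := congrFun (lyap_PK h1 Q R) i
    rw [opL_sub]
    simp only [Pi.sub_apply] at e1 e2 ⊢
    rw [sub_sub_sub_comm, e1, e2]
    abel
  have hdec : 2 * η * mu piv Sg * ∑ i, (W i).trace ≤
      cost Pr A B Q R piv Sg K - cost Pr A B Q R piv Sg K' := by
    rw [hcost, ← hPdef, Finset.mul_sum]
    refine Finset.sum_le_sum fun i _ => ?_
    obtain ⟨D, hD⟩ : ∃ D, D = P - PK Pr A B Q R K' := ⟨_, rfl⟩
    have hr := hres K' hstab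
    rw [← hD] at hr ⊢
    simp only [hgn, neg_neg] at hr
    have hDp : ∀ i, (D i).PosSemidef := psd_sol hPr hstab D fun i => by
      rw [hr]; exact (hW i).smul hη1
    have e1 : D i - (2 * η) • W i =
        opL Pr (Gam A B K') D i + (2 * η - 4 * η ^ 2) • W i := by
      have := hr i
      rw [Pi.sub_apply, sub_eq_iff_eq_add] at this
      rw [this]
      module
    have e2 : (D i - (2 * η) • W i).PosSemidef := by
      rw [e1]
      exact (psd_opL hPr _ hDp i).add ((hW i).smul (by nlinarith))
    have e3 := trace_mul_nonneg' e2 (hSg.posSemidef.smul (hpiv i).le)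
    have e4 := trace_mul_nonneg' (hW i) (hmu i)
    rw [Matrix.sub_mul, Matrix.trace_sub, Matrix.smul_mul, Matrix.trace_smul, smul_eq_mul] at e3
    rw [Matrix.mul_sub, Matrix.trace_sub, Matrix.mul_smul _ (mu piv Sg), Matrix.mul_one,
      Matrix.trace_smul _ (W i), smul_eq_mul] at e4
    have := mul_nonneg hη0.le e4
    linarith
  -- the gap to the optimal policy
  have hX0 : ∀ i, (piv i • Sg).PosSemidef := fun i => hSg.posSemidef.smul (hpiv i).le
  have hX : ∀ i, (X i).PosSemidef := psd_of_hasSum (opT_summable hKs (fun i => piv i • Sg)).hasSum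
    (fun t => psd_opT_iter hPr _ hX0 t)
  have hfix : X = (fun i => piv i • Sg) + opT Pr (Gam A B Ks) X := opT_fix hKs piv Sg
  have hmax : ∀ i, (maxNorm X • (1 : Matrix (Fin d) (Fin d) ℝ) - X i).PosSemidef := psd_maxNorm hX
  have hgap : cost Pr A B Q R piv Sg K - cost Pr A B Q R piv Sg Ks ≤
      maxNorm X * ∑ i, (W i).trace := by
    obtain ⟨Z, hZ⟩ := exists_sol hKs W
    obtain ⟨D, hD⟩ : ∃ D, D = P - PK Pr A B Q R Ks := ⟨_, rfl⟩
    have hr := hres Ks hKs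
    rw [← hD] at hr
    have hZD : ∀ i, ((Z - D) i).PosSemidef := psd_sol hPr hKs (Z - D) fun i => by
      have e : (Z - D - opL Pr (Gam A B Ks) (Z - D)) i =
          ((S i)⁻¹ * L i + (Ks i - K i))ᵀ * S i * ((S i)⁻¹ * L i + (Ks i - K i)) := by
        rw [← hsq, opL_sub, sub_sub_sub_comm, hZ, Pi.sub_apply, hr, sub_neg_eq_add]
      rw [e]
      exact psd_conj (hS i).posSemidef _
    have e1 : cost Pr A B Q R piv Sg K - cost Pr A B Q R piv Sg Ks ≤
        ∑ i, (Z i * (piv i • Sg)).trace := by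
      rw [hcost, ← hPdef, ← hD]
      refine Finset.sum_le_sum fun i _ => ?_
      have := trace_mul_nonneg' (hZD i) (hX0 i)
      rw [Pi.sub_apply, Matrix.sub_mul, Matrix.trace_sub] at this
      linarith
    have e2 : ∑ i, (Z i * (piv i • Sg)).trace = ∑ i, (W i * X i).trace := by
      have f1 : ∑ i, (Z i * X i).trace =
          ∑ i, (Z i * (piv i • Sg)).trace + ∑ i, (Z i * opT Pr (Gam A B Ks) X i).trace := by
        rw [← Finset.sum_add_distrib]
        refine Finset.sum_congr rfl fun i _ => ?_
        rw [← Matrix.trace_add, ← Matrix.mul_add]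
        congr 2
        exact congrFun hfix i
      have f2 : ∑ i, (W i * X i).trace =
          ∑ i, (Z i * X i).trace - ∑ i, (opL Pr (Gam A B Ks) Z i * X i).trace := by
        rw [← Finset.sum_sub_distrib]
        refine Finset.sum_congr rfl fun i _ => ?_
        rw [← Matrix.trace_sub, ← Matrix.sub_mul, ← hZ, Pi.sub_apply]
      rw [f2, duality, f1]
      ring
    refine e1.trans (e2.le.trans ?_)
    rw [Finset.mul_sum]
    refine Finset.sum_le_sum fun i _ => ?_
    have := trace_mul_nonneg' (hW i) (hmax i)
    rw [Matrix.mul_sub, Matrix.trace_sub, Matrix.mul_smul, Matrix.mul_one, Matrix.trace_smul,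
      smul_eq_mul] at this
    linarith
  have hle : mu piv Sg ≤ maxNorm X := by
    let i : Fin N := ⟨0, hN⟩
    have e1 : (X i - piv i • Sg).PosSemidef := by
      have : X i = piv i • Sg + opT Pr (Gam A B Ks) X i := congrFun hfix i
      rw [this, add_sub_cancel_left]
      exact psd_opT hPr _ hX i
    have e2 := ((hmax i).add (e1.add (hmu i))).diag_nonneg (i := ⟨0, hd⟩)
    simp at e2
    linarith
  have hm0 : 0 ≤ maxNorm X := hmu0.trans hle
  refine ⟨hstab, ?_, ?_⟩
  · rw [sub_nonneg]
    refine div_le_one_of_le₀ ?_ hm0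
    nlinarith
  · have htr : 0 ≤ ∑ i, (W i).trace := Finset.sum_nonneg fun i _ => (hW i).trace_nonneg
    rcases hm0.eq_or_lt with h0 | h0
    · rw [← h0]
      have : 0 ≤ 2 * η * mu piv Sg * ∑ i, (W i).trace := by positivity
      simp
      linarith
    · have e : 2 * mu piv Sg * η / maxNorm X *
          (cost Pr A B Q R piv Sg K - cost Pr A B Q R piv Sg Ks) ≤
          2 * η * mu piv Sg * ∑ i, (W i).trace := by
        calc _ ≤ 2 * mu piv Sg * η / maxNorm X * (maxNorm X * ∑ i, (W i).trace) :=
              mul_le_mul_of_nonneg_left hgap (by positivity)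
          _ = _ := by field_simp
      linarith

/-- global linear convergence of the Gauss-Newton method. -/
theorem gauss_newton_global_linear_convergence
    (d k N : ℕ) (hd : 0 < d) (hk : 0 < k) (hN : 0 < N)
    (A : Fin N → Matrix (Fin d) (Fin d) ℝ) (B : Fin N → Matrix (Fin d) (Fin k) ℝ)
    (Pr : Matrix (Fin N) (Fin N) ℝ)
    (hPr : ∀ i j, 0 ≤ Pr i j) (hPrSum : ∀ i, ∑ j, Pr i j = 1)
    (piv : Fin N → ℝ) (hpiv : ∀ i, 0 < piv i) (hpivSum : ∑ i, piv i = 1)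
    (Sg : Matrix (Fin d) (Fin d) ℝ) (hSg : Sg.PosDef)
    (Q : Fin N → Matrix (Fin d) (Fin d) ℝ) (hQ : ∀ i, (Q i).PosDef)
    (R : Fin N → Matrix (Fin k) (Fin k) ℝ) (hR : ∀ i, (R i).PosDef)
    (K0 : Fin N → Matrix (Fin k) (Fin d) ℝ) (hK0 : MSS Pr A B K0)
    (η : ℝ) (hη0 : 0 < η) (hη : η ≤ 1 / 2)
    (Ks : Fin N → Matrix (Fin k) (Fin d) ℝ) (hKs : MSS Pr A B Ks)
    (hopt : ∀ K' : Fin N → Matrix (Fin k) (Fin d) ℝ, MSS Pr A B K' → cost Pr A B Q R piv Sg Ks ≤ cost Pr A B Q R piv Sg K')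
    (Kseq : ℕ → Fin N → Matrix (Fin k) (Fin d) ℝ) (hinit : Kseq 0 = K0)
    (hstep : ∀ n, Kseq (n + 1) = fun i => Kseq n i
      - (2 * η) • ((R i + (B i)ᵀ * opE Pr (PK Pr A B Q R (Kseq n)) i * B i)⁻¹
          * LK Pr A B Q R (Kseq n) i)) :
    ∀ n, MSS Pr A B (Kseq n) ∧
      cost Pr A B Q R piv Sg (Kseq n) - cost Pr A B Q R piv Sg Ks
        ≤ (1 - 2 * mu piv Sg * η / maxNorm (XK Pr piv Sg (Gam A B Ks))) ^ n
            * (cost Pr A B Q R piv Sg K0 - cost Pr A B Q R piv Sg Ks) := by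
  intro n
  induction n with
  | zero => rw [hinit]; exact ⟨hK0, by simp⟩
  | succ n ih =>
    obtain ⟨h1, h2, h3⟩ := gn_step hd hN A B Pr hPr piv hpiv Sg hSg Q hQ R hR η hη0 hη Ks hKs
      (Kseq n) (Kseq (n + 1)) ih.1 (hstep n)
    refine ⟨h1, h3.trans ?_⟩
    have h4 := mul_le_mul_of_nonneg_left ih.2 h2
    rwa [← mul_assoc, ← pow_succ'] at h4

end MJLS
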